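/- Let z^i_j ∈ ℂ² be twelve spinors indexed by ordered pairs of distinct vertices i, j ∈ {1,2,3,4}. Define the 8×8 complex matrix X in sixteen 2×2 blocks by X_ii := 0, and for i < j: X_ij := |z^i_j⟩[z^j_i| and X_ji := −|z^j_i⟩[z^i_j|. For a cycle (a₁ a₂ … a_p) of distinct vertices, set A_{a₁a₂…a_p} := [z^{a₁}_{a_p}|z^{a₁}_{a₂}⟩ · [z^{a₂}_{a₁}|z^{a₂}_{a₃}⟩ · … · [z^{a_p}_{a_{p−1}}|z^{a_p}_{a₁}⟩. Then det(I₈ + X) = (1 − A₁₂₃ − A₁₂₄ − A₁₃₄ − A₂₃₄ + A₁₂₃₄ − A₁₂₄₃ − A₁₃₂₄)². (This is the loop-cycle evaluation of the generating functional of coherent spin network amplitudes for the 3-simplex (tetrahedral) graph, whose power-series coefficients are the 6j symbols.) -/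

import Mathlib

/-!
STATEMENT 16: loop-cycle evaluation of the generating functional of the
coherent 3-simplex (tetrahedral) graph:
det(I₈ + X) = (1 − A₁₂₃ − A₁₂₄ − A₁₃₄ − A₂₃₄ + A₁₂₃₄ − A₁₂₄₃ − A₁₃₂₄)².
Vertices 1,2,3,4 are represented by `0,1,2,3 : Fin 4`.
-/

noncomputable section

abbrev Spinor := Fin 2 → ℂ

/-- The holomorphic bracket `[z|w⟩ = z₀w₁ − z₁w₀`. -/
def bra (z w : Spinor) : ℂ := z 0 * w 1 - z 1 * w 0

/-- The covector `[w| = (−w₁, w₀)` (no conjugation). -/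
def braRow (w : Spinor) : Fin 2 → ℂ := ![-(w 1), w 0]

/-- The 8×8 matrix X of the 3-simplex, in 2×2 blocks: X_ii = 0, and for
i < j, X_ij = |z^i_j⟩[z^j_i|, X_ji = −|z^j_i⟩[z^i_j|. -/
def Xsimplex (z : Fin 4 → Fin 4 → Spinor) :
    Matrix (Fin 4 × Fin 2) (Fin 4 × Fin 2) ℂ :=
  Matrix.of fun p q =>
    if p.1 = q.1 then 0
    else if p.1 < q.1 then z p.1 q.1 p.2 * braRow (z q.1 p.1) q.2
    else - (z p.1 q.1 p.2 * braRow (z q.1 p.1) q.2)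

open Matrix

/-- For `2 × 2` blocks, with the adjugate as quaternionic conjugation, the determinant of a
self-adjoint two-vertex matrix is the square of `a * b - det M`. -/
lemma det_fromBlocks_smul_one_adjugate {R : Type*} [CommRing R] (a b : R)
    (M : Matrix (Fin 2) (Fin 2) R) :
    (fromBlocks (a • 1) M M.adjugate (b • 1)).det = (a * b - M.det) ^ 2 := by
  rw [← det_submatrix_equiv_self finSumFinEquiv.symm]
  have h : (fromBlocks (a • 1) M M.adjugate (b • 1)).submatrix
      (finSumFinEquiv (m := 2) (n := 2)).symm (finSumFinEquiv (m := 2) (n := 2)).symm =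
      !![a, 0, M 0 0, M 0 1; 0, a, M 1 0, M 1 1;
        M 1 1, -M 0 1, b, 0; -M 1 0, M 0 0, 0, b] := by
    ext i j
    fin_cases i <;> fin_cases j <;>
      simp [adjugate_fin_two, finSumFinEquiv, Fin.addCases, Fin.subNat, Fin.castLT]
  rw [h, det_fin_two]
  simp [det_succ_row_zero, Fin.sum_univ_succ, Fin.succAbove]
  ring

/-- Elimination of the first vertex of a three-vertex self-adjoint quaternionic matrix. -/
lemma det_fromBlocks_one_fromCols {R : Type*} [CommRing R] (P Q S : Matrix (Fin 2) (Fin 2) R) :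
    (fromBlocks 1 (fromCols P Q) (fromRows P.adjugate Q.adjugate)
      (fromBlocks 1 S S.adjugate 1)).det =
      ((1 - P.det) * (1 - Q.det) - (S - P.adjugate * Q).det) ^ 2 := by
  rw [det_fromBlocks_one₁₁, fromRows_mul_fromCols, sub_eq_add_neg (fromBlocks _ _ _ _),
    fromBlocks_neg, fromBlocks_add, ← det_fromBlocks_smul_one_adjugate]
  congr 2
  · rw [adjugate_mul, sub_smul, one_smul, sub_eq_add_neg]
  · rw [sub_eq_add_neg]
  · ext i j
    fin_cases i <;> fin_cases j <;>
      simp [adjugate_fin_two, vecMul, dotProduct, Fin.sum_univ_two] <;> ring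
  · rw [adjugate_mul, sub_smul, one_smul, sub_eq_add_neg]

/-- The decomposition of `Fin 4 × Fin 2` into its four blocks. -/
def simplexBlockEquiv : Fin 2 ⊕ Fin 2 ⊕ Fin 2 ⊕ Fin 2 ≃ Fin 4 × Fin 2 where
  toFun := Sum.elim (fun a => (0, a)) (Sum.elim (fun a => (1, a))
    (Sum.elim (fun a => (2, a)) (fun a => (3, a))))
  invFun p := ![.inl p.2, .inr (.inl p.2), .inr (.inr (.inl p.2)), .inr (.inr (.inr p.2))] p.1
  left_inv := by rintro (a | a | a | a) <;> rfl
  right_inv := by rintro ⟨i, a⟩; fin_cases i <;> rfl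

/-- The block `|z⟩[w|`. -/
def ketBra (z w : Spinor) : Matrix (Fin 2) (Fin 2) ℂ :=
  vecMulVec z (braRow w)

lemma ketBra_eq (z w : Spinor) :
    ketBra z w = !![-(z 0 * w 1), z 0 * w 0; -(z 1 * w 1), z 1 * w 0] := by
  ext i j
  fin_cases i <;> fin_cases j <;> simp [ketBra, vecMulVec_apply, braRow]

lemma ketBra_mul_ketBra (x y z w : Spinor) :
    ketBra x y * ketBra z w = bra y z • ketBra x w := by
  ext i j
  fin_cases i <;> fin_cases j <;>
    simp [ketBra_eq, bra, mul_apply, Fin.sum_univ_two] <;> ring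

lemma bra_self (z : Spinor) : bra z z = 0 := by
  rw [bra]
  ring

lemma one_add_Xsimplex_submatrix (z : Fin 4 → Fin 4 → Spinor) :
    (1 + Xsimplex z).submatrix simplexBlockEquiv simplexBlockEquiv =
      fromBlocks 1
        (fromCols (ketBra (z 0 1) (z 1 0))
          (fromCols (ketBra (z 0 2) (z 2 0)) (ketBra (z 0 3) (z 3 0))))
        (fromRows (-ketBra (z 1 0) (z 0 1))
          (fromRows (-ketBra (z 2 0) (z 0 2)) (-ketBra (z 3 0) (z 0 3))))
        (fromBlocks 1
          (fromCols (ketBra (z 1 2) (z 2 1)) (ketBra (z 1 3) (z 3 1)))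
          (fromRows (-ketBra (z 2 1) (z 1 2)) (-ketBra (z 3 1) (z 1 3)))
          (fromBlocks 1 (ketBra (z 2 3) (z 3 2)) (-ketBra (z 3 2) (z 2 3)) 1)) := by
  ext i j
  rcases i with i | i | i | i <;> rcases j with j | j | j | j <;>
    simp [simplexBlockEquiv, Xsimplex, ketBra, vecMulVec_apply, one_apply]

/-- The Schur complement of the first vertex is again self-adjoint with unit diagonal. -/
lemma det_one_add_Xsimplex (z : Fin 4 → Fin 4 → Spinor) :
    (1 + Xsimplex z).det =
      (fromBlocks 1
        (fromCols
          (ketBra (z 1 2) (z 2 1) + bra (z 0 1) (z 0 2) • ketBra (z 1 0) (z 2 0))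
          (ketBra (z 1 3) (z 3 1) + bra (z 0 1) (z 0 3) • ketBra (z 1 0) (z 3 0)))
        (fromRows
          (ketBra (z 1 2) (z 2 1) + bra (z 0 1) (z 0 2) • ketBra (z 1 0) (z 2 0)).adjugate
          (ketBra (z 1 3) (z 3 1) + bra (z 0 1) (z 0 3) • ketBra (z 1 0) (z 3 0)).adjugate)
        (fromBlocks 1
          (ketBra (z 2 3) (z 3 2) + bra (z 0 2) (z 0 3) • ketBra (z 2 0) (z 3 0))
          (ketBra (z 2 3) (z 3 2) + bra (z 0 2) (z 0 3) • ketBra (z 2 0) (z 3 0)).adjugate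
          1)).det := by
  rw [← det_submatrix_equiv_self simplexBlockEquiv, one_add_Xsimplex_submatrix,
    det_fromBlocks_one₁₁]
  congr 1
  ext i j
  rcases i with i | i | i <;> rcases j with j | j | j <;>
    simp only [fromRows_mul, mul_fromCols, neg_mul, ketBra_mul_ketBra, bra_self, zero_smul,
      neg_zero, Matrix.sub_apply, fromBlocks_apply₁₁, fromBlocks_apply₁₂, fromBlocks_apply₂₁,
      fromBlocks_apply₂₂, fromCols_apply_inl, fromCols_apply_inr, fromRows_apply_inl,
      fromRows_apply_inr, Matrix.zero_apply, sub_zero, Matrix.neg_apply, Matrix.add_apply,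
      sub_neg_eq_add] <;>
    fin_cases i <;> fin_cases j <;> simp [ketBra_eq, adjugate_fin_two, bra] <;> ring

theorem three_simplex_generating_functional (z : Fin 4 → Fin 4 → Spinor) :
    (1 + Xsimplex z).det =
      ((1 : ℂ)
        - bra (z 0 2) (z 0 1) * bra (z 1 0) (z 1 2) * bra (z 2 1) (z 2 0)   -- A₁₂₃
        - bra (z 0 3) (z 0 1) * bra (z 1 0) (z 1 3) * bra (z 3 1) (z 3 0)   -- A₁₂₄
        - bra (z 0 3) (z 0 2) * bra (z 2 0) (z 2 3) * bra (z 3 2) (z 3 0)   -- A₁₃₄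
        - bra (z 1 3) (z 1 2) * bra (z 2 1) (z 2 3) * bra (z 3 2) (z 3 1)   -- A₂₃₄
        + bra (z 0 3) (z 0 1) * bra (z 1 0) (z 1 2) * bra (z 2 1) (z 2 3)
            * bra (z 3 2) (z 3 0)                                           -- A₁₂₃₄
        - bra (z 0 2) (z 0 1) * bra (z 1 0) (z 1 3) * bra (z 3 1) (z 3 2)
            * bra (z 2 3) (z 2 0)                                           -- A₁₂₄₃
        - bra (z 0 3) (z 0 2) * bra (z 2 0) (z 2 1) * bra (z 1 2) (z 1 3)
            * bra (z 3 1) (z 3 0)) ^ 2 := by                                 -- A₁₃₂₄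
  rw [det_one_add_Xsimplex, det_fromBlocks_one_fromCols]
  congr 1
  simp [ketBra_eq, adjugate_fin_two, det_fin_two, bra]
  ring
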